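/- There exists a bounded sequence w = (w_n)_{n≥1} of positive real numbers such that the weighted backward shift B_w on c₀(ℤ₊) is frequently hypercyclic but not D̄₁-transitive: there exist non-empty open sets U, V ⊆ c₀(ℤ₊) such that the set N(U,V) := {n ∈ ℕ : B_wⁿ(U) ∩ V ≠ ∅} has upper density strictly less than 1. -/

import Mathlib

open Filter Topology Set
open scoped Classical ZeroAtInfty

/-- The lower density of a set `A ⊆ ℕ`: `liminf_{N→∞} #(A ∩ [1,N]) / N`. -/
noncomputable def lowerDensity (A : Set ℕ) : ℝ :=
  Filter.atTop.liminf fun N : ℕ => (((Finset.Icc 1 N).filter (· ∈ A)).card : ℝ) / N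

/-- The upper density of a set `A ⊆ ℕ`: `limsup_{N→∞} #(A ∩ [1,N]) / N`. -/
noncomputable def upperDensity (A : Set ℕ) : ℝ :=
  Filter.atTop.limsup fun N : ℕ => (((Finset.Icc 1 N).filter (· ∈ A)).card : ℝ) / N

/-- The visit set `N_T(x,V) = {n ∈ ℕ : Tⁿ x ∈ V}`. -/
def visitSet {X : Type*} [TopologicalSpace X] [AddCommGroup X] [Module ℝ X]
    (T : X →L[ℝ] X) (x : X) (V : Set X) : Set ℕ :=
  {n : ℕ | (T ^ n) x ∈ V}

/-- `T` is frequently hypercyclic. -/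
def FrequentlyHypercyclic {X : Type*} [TopologicalSpace X] [AddCommGroup X] [Module ℝ X]
    (T : X →L[ℝ] X) : Prop :=
  ∃ x : X, ∀ V : Set X, IsOpen V → V.Nonempty → 0 < lowerDensity (visitSet T x V)

/-- distance to the last element outside the bad set `G` -/
noncomputable def hgt (G : Set ℕ) : ℕ → ℕ
  | 0 => 0
  | n + 1 => if n + 1 ∈ G then hgt G n + 1 else 0

lemma hgt_succ_le (G : Set ℕ) (n : ℕ) : hgt G (n + 1) ≤ hgt G n + 1 := by
  rw [hgt]; split_ifs <;> omega

lemma hgt_ge (G : Set ℕ) (b d : ℕ) (H : ∀ j, b < j → j ≤ b + d → j ∈ G) : d ≤ hgt G (b + d) := by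
  induction d with
  | zero => simp
  | succ d ih =>
    have h1 := ih (fun j h1 h2 => H j h1 (by omega))
    have h2 : b + d + 1 ∈ G := H _ (by omega) (by omega)
    rw [← add_assoc, hgt, if_pos h2]
    omega

lemma hgt_ge' (G : Set ℕ) (b i : ℕ) (hb : b ≤ i) (H : ∀ j, b < j → j ≤ i → j ∈ G) :
    i - b ≤ hgt G i := by
  have := hgt_ge G b (i - b) (fun j h1 h2 => H j h1 (by omega))
  rwa [Nat.add_sub_cancel' hb] at this

lemma mem_of_hgt_ne {G : Set ℕ} {n : ℕ} (h : hgt G n ≠ 0) : n ∈ G := by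
  cases n with
  | zero => simp [hgt] at h
  | succ n =>
    by_contra hn
    rw [hgt, if_neg hn] at h
    exact h rfl

lemma ratio_bounds (A : Set ℕ) (N : ℕ) :
    0 ≤ (((Finset.Icc 1 N).filter (· ∈ A)).card : ℝ) / N ∧
    (((Finset.Icc 1 N).filter (· ∈ A)).card : ℝ) / N ≤ 1 := by
  refine ⟨by positivity, ?_⟩
  apply div_le_one_of_le₀ _ (by positivity)
  have : ((Finset.Icc 1 N).filter (· ∈ A)).card ≤ N := by
    calc _ ≤ (Finset.Icc 1 N).card := Finset.card_filter_le _ _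
      _ = N := by simp
  exact_mod_cast this

lemma lowerDensity_pos_of (A : Set ℕ) (c : ℝ) (hc : 0 < c)
    (h : ∀ᶠ N : ℕ in atTop, c * N ≤ (((Finset.Icc 1 N).filter (· ∈ A)).card : ℝ)) :
    0 < lowerDensity A := by
  refine lt_of_lt_of_le hc ?_
  unfold lowerDensity
  refine le_liminf_of_le ?_ ?_
  · exact (isBoundedUnder_of ⟨1, fun N => (ratio_bounds A N).2⟩).isCoboundedUnder_ge
  · filter_upwards [h, eventually_gt_atTop 0] with N hN h0
    rw [le_div_iff₀ (by exact_mod_cast h0)]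
    exact hN

lemma upperDensity_lt_of (A : Set ℕ) (c : ℝ) (hc : c < 1)
    (h : ∀ᶠ N : ℕ in atTop, (((Finset.Icc 1 N).filter (· ∈ A)).card : ℝ) ≤ c * N) :
    upperDensity A < 1 := by
  refine lt_of_le_of_lt ?_ hc
  unfold upperDensity
  refine limsup_le_of_le ?_ ?_
  · exact (isBoundedUnder_of ⟨0, fun N => (ratio_bounds A N).1⟩).isCoboundedUnder_le
  · filter_upwards [h, eventually_gt_atTop 0] with N hN h0
    rw [div_le_iff₀ (by exact_mod_cast h0)]
    exact hN

lemma card_mono_set {A B : Set ℕ} (N : ℕ) (h : A ⊆ B) :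
    ((Finset.Icc 1 N).filter (· ∈ A)).card ≤ ((Finset.Icc 1 N).filter (· ∈ B)).card := by
  apply Finset.card_le_card
  intro x hx
  simp only [Finset.mem_filter] at hx ⊢
  exact ⟨hx.1, h hx.2⟩

lemma lowerDensity_mono {A B : Set ℕ} (h : A ⊆ B) : lowerDensity A ≤ lowerDensity B := by
  unfold lowerDensity
  refine liminf_le_liminf ?_ ?_ ?_
  · refine Eventually.of_forall fun N => ?_
    have := card_mono_set N h
    exact div_le_div_of_nonneg_right (by exact_mod_cast this) (Nat.cast_nonneg N)
  · exact isBoundedUnder_of ⟨0, fun N => (ratio_bounds A N).1⟩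
  · exact (isBoundedUnder_of ⟨1, fun N => (ratio_bounds B N).2⟩).isCoboundedUnder_ge

lemma upperDensity_mono {A B : Set ℕ} (h : A ⊆ B) : upperDensity A ≤ upperDensity B := by
  unfold upperDensity
  refine limsup_le_limsup ?_ ?_ ?_
  · refine Eventually.of_forall fun N => ?_
    have := card_mono_set N h
    exact div_le_div_of_nonneg_right (by exact_mod_cast this) (Nat.cast_nonneg N)
  · exact (isBoundedUnder_of ⟨0, fun N => (ratio_bounds A N).1⟩).isCoboundedUnder_le
  · exact isBoundedUnder_of ⟨1, fun N => (ratio_bounds B N).2⟩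

/-- exponent -/
def ee (g : ℕ → ℕ) (p : ℕ) : ℕ := p + 6 + 3 * g p

def G1 : Set ℕ := {n | ∃ u, 16 ^ u ≤ 2 * n ∧ n < 3 * 16 ^ u}
def G2 (g : ℕ → ℕ) : Set ℕ :=
  {n | ∃ p k, 1 ≤ k ∧ k * 2 ^ ee g p < n + 2 * g p ∧ n ≤ k * 2 ^ ee g p + g p}
def EE (g : ℕ → ℕ) (p : ℕ) : Set ℕ :=
  {n | ∃ u, ee g p ≤ u ∧ padicValNat 2 u = p ∧ 16 ^ u ≤ n ∧ n < 2 * 16 ^ u ∧ 2 ^ ee g p ∣ n}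

lemma NN_ge (g : ℕ → ℕ) (p : ℕ) : 2 ^ (p + 6) * (3 * g p + 1) ≤ 2 ^ ee g p := by
  unfold ee
  rw [pow_add 2 (p + 6)]
  have : 3 * g p < 2 ^ (3 * g p) := Nat.lt_two_pow_self
  gcongr
  omega

lemma NN_ge' (g : ℕ → ℕ) (p : ℕ) : 64 * (3 * g p + 1) ≤ 2 ^ ee g p := by
  refine le_trans ?_ (NN_ge g p)
  have : 1 ≤ 2 ^ p := Nat.one_le_two_pow
  have h : 64 ≤ 2 ^ (p + 6) := by rw [pow_add]; omega
  gcongr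

lemma pow16 (u : ℕ) : 4 * u < 16 ^ u := by
  induction u with
  | zero => simp
  | succ u ih => rw [pow_succ]; omega

lemma pow16_lt {u v : ℕ} (h : u < v) : 16 * 16 ^ u ≤ 16 ^ v := by
  rw [← pow_succ']
  exact Nat.pow_le_pow_right (by norm_num) h

lemma EE_diff (g : ℕ → ℕ) (p q n m k : ℕ) (hn : n ∈ EE g p) (hm : m ∈ EE g q) (hmn : m < n)
    (hk : k ≤ g p) : g p + g q ≤ hgt (G1 ∪ G2 g) (n + k - m) := by
  obtain ⟨u, hu1, hu2, hu3, hu4, hu5⟩ := hn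
  obtain ⟨v, hv1, hv2, hv3, hv4, hv5⟩ := hm
  have hpu := pow16 u
  rcases lt_trichotomy u v with h | h | h
  · have := pow16_lt h
    omega
  · subst h
    have hpq : p = q := by omega
    subst hpq
    have hd := Nat.dvd_sub hu5 hv5
    obtain ⟨s, hs⟩ := hd
    have hs1 : 1 ≤ s := by
      rcases Nat.eq_zero_or_pos s with h0 | h0
      · subst h0; omega
      · exact h0
    have hN := NN_ge' g p
    have hsN : 2 ^ ee g p ≤ 2 ^ ee g p * s := Nat.le_mul_of_pos_right _ hs1
    have := hgt_ge' (G1 ∪ G2 g) (n + k - m - 2 * g p) (n + k - m) (by omega) (by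
      intro j h1 h2
      right
      refine ⟨p, s, hs1, ?_, ?_⟩ <;> rw [mul_comm] <;> omega)
    omega
  · have := pow16_lt h
    unfold ee at hu1 hv1
    have := hgt_ge' (G1 ∪ G2 g) (16 ^ u / 2) (n + k - m) (by omega) (by
      intro j h1 h2
      left
      exact ⟨u, by omega, by omega⟩)
    omega

lemma EE_disj (g : ℕ → ℕ) (p q n m k l : ℕ) (hn : n ∈ EE g p) (hm : m ∈ EE g q)
    (hk : k ≤ g p) (hl : l ≤ g q) (h : n + k = m + l) : p = q ∧ n = m := by
  obtain ⟨u, hu1, hu2, hu3, hu4, hu5⟩ := hn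
  obtain ⟨v, hv1, hv2, hv3, hv4, hv5⟩ := hm
  have hpu := pow16 u
  have hpv := pow16 v
  rcases lt_trichotomy u v with h' | h' | h'
  · have := pow16_lt h'
    unfold ee at hu1 hv1
    omega
  · subst h'
    have hpq : p = q := by omega
    subst hpq
    refine ⟨rfl, ?_⟩
    have hN := NN_ge' g p
    have h1 := Nat.dvd_sub hu5 hv5
    have h2 := Nat.dvd_sub hv5 hu5
    have h3 := Nat.eq_zero_of_dvd_of_lt h1 (by omega)
    have h4 := Nat.eq_zero_of_dvd_of_lt h2 (by omega)
    omega
  · have := pow16_lt h'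
    unfold ee at hu1 hv1
    omega

lemma EE_inf (g : ℕ → ℕ) (p n k : ℕ) (hn : n ∈ EE g p)
    (hk : k ≤ g p) : g p + (n + k) / 16 ≤ hgt (G1 ∪ G2 g) (n + k) := by
  obtain ⟨u, hu1, hu2, hu3, hu4, hu5⟩ := hn
  have hpu := pow16 u
  unfold ee at hu1
  have := hgt_ge' (G1 ∪ G2 g) (16 ^ u / 2) (n + k) (by omega) (by
      intro j h1 h2
      left
      exact ⟨u, by omega, by omega⟩)
  omega

lemma EE_count (g : ℕ → ℕ) (p u N : ℕ) (h1 : ee g p ≤ u) (h2 : padicValNat 2 u = p)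
    (h3 : 2 * 16 ^ u ≤ N) :
    (16 : ℝ) ^ u / 2 ^ ee g p ≤ (((Finset.Icc 1 N).filter (· ∈ EE g p)).card : ℝ) := by
  have hd : 2 ^ ee g p ∣ 16 ^ u := by
    have : (16 : ℕ) ^ u = 2 ^ (4 * u) := by rw [pow_mul]; norm_num
    rw [this]
    exact pow_dvd_pow 2 (by omega)
  obtain ⟨t, ht⟩ := hd
  have hpos : 0 < 2 ^ ee g p := by positivity
  have hpu := pow16 u
  have key : t ≤ ((Finset.Icc 1 N).filter (· ∈ EE g p)).card := by
    have : ((Finset.range t).image (fun s => 2 ^ ee g p * (t + s))).card = t := by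
      rw [Finset.card_image_of_injective]
      · simp
      · intro a b hab
        have := Nat.eq_of_mul_eq_mul_left hpos hab
        omega
    rw [← this]
    apply Finset.card_le_card
    intro x hx
    simp only [Finset.mem_image, Finset.mem_range, Finset.mem_filter, Finset.mem_Icc] at hx ⊢
    obtain ⟨s, hs, rfl⟩ := hx
    have h5 : 2 ^ ee g p * (t + s) = 16 ^ u + 2 ^ ee g p * s := by rw [ht]; ring
    have h6 : 2 ^ ee g p * s < 16 ^ u := by rw [ht]; gcongr
    refine ⟨by omega, u, h1, h2, by omega, by omega, dvd_mul_right _ _⟩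
  have h4 : (16 : ℝ) ^ u = 2 ^ ee g p * t := by exact_mod_cast ht
  rw [h4, mul_div_cancel_left₀ _ (by positivity)]
  exact_mod_cast key

lemma EE_density (g : ℕ → ℕ) (p : ℕ) : 0 < lowerDensity (EE g p) := by
  set D := 2 ^ (p + 1) + 2 ^ p with hD
  apply lowerDensity_pos_of _ (1 / (2 ^ ee g p * 16 ^ (D + 2))) (by positivity)
  filter_upwards [eventually_ge_atTop (16 ^ (ee g p + D + 1))] with N hN
  have hN0 : N ≠ 0 := by
    have : 0 < 16 ^ (ee g p + D + 1) := by positivity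
    omega
  set L := Nat.log 16 N with hL
  have hL1 : ee g p + D + 1 ≤ L := by
    rw [hL]; exact (Nat.le_log_iff_pow_le (by norm_num) hN0).2 hN
  have hL2 : N < 16 ^ (L + 1) := Nat.lt_pow_succ_log_self (by norm_num) N
  have hL3 : 16 ^ L ≤ N := Nat.pow_log_le_self 16 hN0
  -- choose u
  obtain ⟨u, hu1, hu2, hu3⟩ : ∃ u, L - 1 - D ≤ u ∧ u ≤ L - 1 ∧ padicValNat 2 u = p := by
    set a := L - 1 - D with ha
    refine ⟨2 ^ p * (2 * (a / 2 ^ (p + 1) + 1) + 1), ?_, ?_, ?_⟩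
    · have h1 := Nat.div_add_mod a (2 ^ (p + 1))
      have h2 := Nat.mod_lt a (show 2 ^ (p + 1) > 0 by positivity)
      have h3 : 2 ^ p * (2 * (a / 2 ^ (p + 1) + 1) + 1)
        = 2 ^ (p + 1) * (a / 2 ^ (p + 1)) + 2 ^ (p + 1) + 2 ^ p := by ring
      omega
    · have h1 := Nat.div_add_mod a (2 ^ (p + 1))
      have h3 : 2 ^ p * (2 * (a / 2 ^ (p + 1) + 1) + 1)
        = 2 ^ (p + 1) * (a / 2 ^ (p + 1)) + 2 ^ (p + 1) + 2 ^ p := by ring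
      omega
    · rw [padicValNat.mul (by positivity) (by positivity), padicValNat.prime_pow,
        padicValNat.eq_zero_of_not_dvd (by omega)]
      rfl
  have h16 := pow16_lt (show u < L by omega)
  refine le_trans ?_ (EE_count g p u N (by omega) hu3 (by omega))
  have hle : (N : ℝ) ≤ 16 ^ (D + 2) * 16 ^ u := by
    rw [← pow_add]
    have : N ≤ 16 ^ (D + 2 + u) := hL2.le.trans (Nat.pow_le_pow_right (by norm_num) (by omega))
    exact_mod_cast this
  rw [div_mul_eq_mul_div, one_mul, div_le_div_iff₀ (by positivity) (by positivity)]
  calc (N : ℝ) * 2 ^ ee g p ≤ (16 ^ (D + 2) * 16 ^ u) * 2 ^ ee g p := by gcongr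
    _ = _ := by ring

lemma G2_count (g : ℕ → ℕ) (M : ℕ) :
    (((Finset.Icc 1 M).filter (· ∈ G2 g)).card : ℝ) ≤ M / 16 := by
  have hsub : (Finset.Icc 1 M).filter (· ∈ G2 g) ⊆
      (Finset.range (2 * M)).biUnion (fun p => (Finset.Icc 1 (2 * M / 2 ^ ee g p)).biUnion
        (fun k => Finset.Ioc (k * 2 ^ ee g p - 2 * g p) (k * 2 ^ ee g p + g p))) := by
    intro n hn
    simp only [Finset.mem_filter, Finset.mem_Icc, Finset.mem_biUnion, Finset.mem_range,
      Finset.mem_Ioc] at hn ⊢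
    obtain ⟨⟨h1, h2⟩, p, k, hk, h3, h4⟩ := hn
    have hN := NN_ge' g p
    have hk' : 2 ^ ee g p ≤ k * 2 ^ ee g p := Nat.le_mul_of_pos_left _ hk
    have hp : p < 2 ^ ee g p := by
      calc p < 2 ^ p := Nat.lt_two_pow_self
        _ ≤ 2 ^ ee g p := Nat.pow_le_pow_right (by norm_num) (by unfold ee; omega)
    refine ⟨p, by omega, k, ⟨hk, ?_⟩, by omega, h4⟩
    rw [Nat.le_div_iff_mul_le (by positivity)]
    omega
  have hc : ((Finset.Icc 1 M).filter (· ∈ G2 g)).card ≤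
      ∑ p ∈ Finset.range (2 * M), (2 * M / 2 ^ ee g p) * (3 * g p) := by
    refine (Finset.card_le_card hsub).trans (Finset.card_biUnion_le.trans ?_)
    apply Finset.sum_le_sum
    intro p _
    refine (Finset.card_biUnion_le_card_mul _ _ (3 * g p) ?_).trans (by simp)
    intro k hk
    simp only [Nat.card_Ioc]
    omega
  have hc' : (((Finset.Icc 1 M).filter (· ∈ G2 g)).card : ℝ) ≤
      ∑ p ∈ Finset.range (2 * M), ((2 * M / 2 ^ ee g p : ℕ) : ℝ) * (3 * g p) := by
    exact_mod_cast hc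
  refine hc'.trans ?_
  calc _ ≤ ∑ p ∈ Finset.range (2 * M), (M / 32 : ℝ) * (1 / 2) ^ p := by
        apply Finset.sum_le_sum
        intro p _
        have h1 : ((2 * M / 2 ^ ee g p : ℕ) : ℝ) ≤ (2 * M : ℝ) / 2 ^ ee g p := by
          refine Nat.cast_div_le.trans ?_
          push_cast
          exact le_rfl
        have h2 : ((2 : ℝ) ^ (p + 6)) * (3 * g p + 1) ≤ 2 ^ ee g p := by
          exact_mod_cast NN_ge g p
        calc _ ≤ (2 * M : ℝ) / 2 ^ ee g p * (3 * g p) := by gcongr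
          _ ≤ (2 * M : ℝ) / (2 ^ (p + 6) * (3 * g p + 1)) * (3 * g p + 1) := by
            gcongr
            linarith
          _ = _ := by
            have : (3 * (g p : ℝ) + 1) ≠ 0 := by positivity
            rw [pow_add, one_div, inv_pow]
            field_simp
            ring
    _ = (M / 32 : ℝ) * ∑ p ∈ Finset.range (2 * M), (1 / 2 : ℝ) ^ p := by rw [Finset.mul_sum]
    _ ≤ (M / 32 : ℝ) * 2 := by
        gcongr
        exact sum_geometric_two_le _
    _ = _ := by ring

lemma G_density (g : ℕ → ℕ) : upperDensity (G1 ∪ G2 g) < 1 := by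
  apply upperDensity_lt_of _ (63 / 64) (by norm_num)
  filter_upwards [eventually_ge_atTop 16] with N hN
  have hN0 : N ≠ 0 := by omega
  obtain ⟨v, hv⟩ : ∃ v, Nat.log 16 N = v + 1 := by
    have : 1 ≤ Nat.log 16 N := (Nat.le_log_iff_pow_le (by norm_num) hN0).2 (by simpa using hN)
    exact ⟨Nat.log 16 N - 1, by omega⟩
  have hL2 : N < 16 ^ (v + 1 + 1) := hv ▸ Nat.lt_pow_succ_log_self (by norm_num) N
  have hL3 : 16 ^ (v + 1) ≤ N := hv ▸ Nat.pow_log_le_self 16 hN0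
  set X := 16 ^ v with hX
  have hX1 : 1 ≤ X := Nat.one_le_pow _ _ (by norm_num)
  have e1 : 16 ^ (v + 1) = 16 * X := by rw [pow_succ']
  have e2 : 16 ^ (v + 1 + 1) = 256 * X := by rw [pow_succ', e1]; ring
  have hG2 := G2_count g (8 * X)
  have hsub : (Finset.Icc 1 N).filter (· ∈ G1 ∪ G2 g) ⊆
      (Finset.Icc 1 N \ Finset.Ico (3 * X) (8 * X)) ∪
        (Finset.Icc 1 (8 * X)).filter (· ∈ G2 g) := by
    intro n hn
    simp only [Finset.mem_filter, Finset.mem_Icc, Finset.mem_union, Finset.mem_sdiff,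
      Finset.mem_Ico, Set.mem_union] at hn ⊢
    obtain ⟨h1, h2⟩ := hn
    by_cases hm : 3 * X ≤ n ∧ n < 8 * X
    · right
      refine ⟨by omega, ?_⟩
      rcases h2 with ⟨u, h3, h4⟩ | h2
      · exfalso
        rcases le_or_gt u v with h | h
        · have : 16 ^ u ≤ X := Nat.pow_le_pow_right (by norm_num) h
          omega
        · have := pow16_lt h
          omega
      · exact h2
    · left
      exact ⟨h1, hm⟩
  have hc : ((Finset.Icc 1 N).filter (· ∈ G1 ∪ G2 g)).card ≤
      (N - 5 * X) + ((Finset.Icc 1 (8 * X)).filter (· ∈ G2 g)).card := by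
    refine (Finset.card_le_card hsub).trans ((Finset.card_union_le _ _).trans ?_)
    gcongr
    rw [Finset.card_sdiff_of_subset]
    · simp only [Nat.card_Icc, Nat.card_Ico]
      omega
    · intro n hn
      simp only [Finset.mem_Icc, Finset.mem_Ico] at hn ⊢
      omega
  have hc' : (((Finset.Icc 1 N).filter (· ∈ G1 ∪ G2 g)).card : ℝ) ≤
      ((N : ℝ) - 5 * X) + (((Finset.Icc 1 (8 * X)).filter (· ∈ G2 g)).card : ℝ) := by
    have : ((N - 5 * X : ℕ) : ℝ) = (N : ℝ) - 5 * X := by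
      rw [Nat.cast_sub (by omega)]; push_cast; ring
    rw [← this]
    exact_mod_cast hc
  have h256 : (N : ℝ) ≤ 256 * X := by
    have : N ≤ 256 * X := by omega
    exact_mod_cast this
  have h8 : ((8 * X : ℕ) : ℝ) = 8 * (X : ℝ) := by push_cast; ring
  rw [h8] at hG2
  have hfin : (((Finset.Icc 1 N).filter (· ∈ G1 ∪ G2 g)).card : ℝ) ≤ 63 / 64 * N := by
    linarith
  convert hfin

lemma dense_data : ∃ (y : ℕ → ℕ → ℝ) (r g : ℕ → ℕ), (∀ p k, g p < k → y p k = 0) ∧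
    (∀ p k, |y p k| * 2 ^ k ≤ 2 ^ g p) ∧ (∀ p, r p ≤ g p) ∧
    (∀ (f : C₀(ℕ, ℝ)) (ε : ℝ), 0 < ε → ∃ p, (1 / 2 : ℝ) ^ r p < ε ∧ ∀ k, |y p k - f k| ≤ ε) := by
  obtain ⟨φ, hφ⟩ := exists_surjective_nat ((ℕ →₀ ℚ) × ℕ)
  have hg : ∀ p, ∃ g : ℕ, (∀ k, g < k → ((φ p).1 k : ℝ) = 0) ∧
      (∀ k, |((φ p).1 k : ℝ)| * 2 ^ k ≤ 2 ^ g) ∧ (φ p).2 ≤ g := by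
    intro p
    set f := (φ p).1
    set S := ∑ k ∈ f.support, |(f k : ℝ)| * 2 ^ k with hS
    refine ⟨(φ p).2 + f.support.sup id + ⌈S⌉₊, ?_, ?_, by omega⟩
    · intro k hk
      by_contra h
      have : k ∈ f.support := by
        rw [Finsupp.mem_support_iff]
        intro h'; apply h; rw [h']; simp
      have := Finset.le_sup (f := id) this
      simp only [id] at this
      omega
    · intro k
      by_cases hk : k ∈ f.support
      · have h1 : |(f k : ℝ)| * 2 ^ k ≤ S :=
          Finset.single_le_sum (f := fun k => |(f k : ℝ)| * 2 ^ k)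
            (fun i _ => by positivity) hk
        have h2 : S ≤ (⌈S⌉₊ : ℝ) := Nat.le_ceil S
        have h3 : (⌈S⌉₊ : ℝ) ≤ 2 ^ ⌈S⌉₊ := by
          exact_mod_cast Nat.lt_two_pow_self.le
        have h4 : (2 : ℝ) ^ ⌈S⌉₊ ≤ 2 ^ ((φ p).2 + f.support.sup id + ⌈S⌉₊) :=
          pow_le_pow_right₀ (by norm_num) (by omega)
        linarith
      · rw [Finsupp.notMem_support_iff] at hk
        rw [hk]
        simp
  choose g hg1 hg2 hg3 using hg
  refine ⟨fun p k => ((φ p).1 k : ℝ), fun p => (φ p).2, g, hg1, hg2, hg3, ?_⟩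
  intro f ε hε
  have hf : Tendsto f atTop (𝓝 0) := by
    have := f.zero_at_infty'
    rwa [cocompact_eq_cofinite, Nat.cofinite_eq_atTop] at this
  obtain ⟨K, hK⟩ := (Metric.tendsto_atTop.1 hf) ε hε
  have hq : ∀ k, ∃ q : ℚ, |(q : ℝ) - f k| < ε := by
    intro k
    obtain ⟨q, h1, h2⟩ := exists_rat_btwn (show f k - ε < f k + ε by linarith)
    exact ⟨q, by rw [abs_lt]; constructor <;> linarith⟩
  choose q hq using hq
  obtain ⟨r, hr⟩ := exists_pow_lt_of_lt_one hε (show (1 / 2 : ℝ) < 1 by norm_num)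
  obtain ⟨p, hp⟩ := hφ (Finsupp.onFinset (Finset.range K) (fun k => if k < K then q k else 0)
    (by intro k hk; by_contra h; simp at h; simp [not_lt.2 h] at hk), r)
  refine ⟨p, ?_, ?_⟩
  · simp only [hp]; exact hr
  · intro k
    simp only [hp, Finsupp.onFinset_apply]
    split_ifs with h
    · exact (hq k).le
    · have := hK k (by omega)
      rw [Real.dist_eq] at this
      rw [abs_sub_comm]
      simpa using this.le

/-- the backward shift operator with weights bounded by 2 -/
lemma exists_shift (w : ℕ → ℝ) (h0 : ∀ n, 0 < w n) (h2 : ∀ n, w n ≤ 2) :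
    ∃ T : C₀(ℕ, ℝ) →L[ℝ] C₀(ℕ, ℝ),
        (∀ (x : C₀(ℕ, ℝ)) (n : ℕ), (T x) n = w (n + 1) * x (n + 1)) := by
  have tend : ∀ x : C₀(ℕ, ℝ), Tendsto (fun n => w (n + 1) * x (n + 1)) (cocompact ℕ) (𝓝 0) := by
    intro x
    have hx : Tendsto x atTop (𝓝 0) := by
      have := x.zero_at_infty'
      rwa [cocompact_eq_cofinite, Nat.cofinite_eq_atTop] at this
    rw [cocompact_eq_cofinite, Nat.cofinite_eq_atTop]
    have h1 : Tendsto (fun n => 2 * |x (n + 1)|) atTop (𝓝 0) := by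
      have := ((hx.comp (tendsto_add_atTop_nat 1)).abs).const_mul 2
      simpa using this
    refine squeeze_zero_norm (fun n => ?_) h1
    rw [norm_mul, Real.norm_eq_abs, Real.norm_eq_abs, abs_of_pos (h0 _)]
    gcongr
    exact h2 _
  let L : C₀(ℕ, ℝ) →ₗ[ℝ] C₀(ℕ, ℝ) :=
    { toFun := fun x => ⟨⟨fun n => w (n + 1) * x (n + 1), continuous_of_discreteTopology⟩, tend x⟩
      map_add' := by
        intro x y; ext n
        show w (n + 1) * (x + y) (n + 1) = w (n + 1) * x (n + 1) + w (n + 1) * y (n + 1)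
        rw [ZeroAtInftyContinuousMap.add_apply]; ring
      map_smul' := by
        intro c x; ext n
        show w (n + 1) * (c • x) (n + 1) = c * (w (n + 1) * x (n + 1))
        rw [ZeroAtInftyContinuousMap.smul_apply, smul_eq_mul]; ring }
  refine ⟨L.mkContinuous 2 ?_, fun x n => rfl⟩
  intro x
  rw [← ZeroAtInftyContinuousMap.norm_toBCF_eq_norm,
    BoundedContinuousFunction.norm_le (by positivity)]
  intro n
  show ‖w (n + 1) * x (n + 1)‖ ≤ _
  have : ‖x (n + 1)‖ ≤ ‖x‖ := by
    rw [← ZeroAtInftyContinuousMap.norm_toBCF_eq_norm]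
    exact x.toBCF.norm_coe_le_norm (n + 1)
  rw [norm_mul, Real.norm_eq_abs (w _), abs_of_pos (h0 _)]
  have := h2 (n + 1)
  gcongr

lemma shift_pow (h : ℕ → ℕ) (w : ℕ → ℝ) (hw : ∀ n, w (n + 1) * 2 ^ h n = 2 ^ h (n + 1))
    (T : C₀(ℕ, ℝ) →L[ℝ] C₀(ℕ, ℝ))
    (hT : ∀ (x : C₀(ℕ, ℝ)) (n : ℕ), (T x) n = w (n + 1) * x (n + 1)) (n : ℕ) :
    ∀ (x : C₀(ℕ, ℝ)) (i : ℕ), ((T ^ n) x) i * 2 ^ h i = 2 ^ h (i + n) * x (i + n) := by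
  induction n with
  | zero => intro x i; simp [mul_comm]
  | succ n ih =>
    intro x i
    rw [pow_succ, mul_apply_eq_comp, ih, hT, ← mul_assoc, mul_comm _ (w _), hw]
    rfl

theorem exists_FHC_shift_not_upperDensityOne_transitive :
    ∃ (w : ℕ → ℝ), (∀ n, 0 < w n) ∧ (∃ C : ℝ, ∀ n, w n ≤ C) ∧
      ∃ T : C₀(ℕ, ℝ) →L[ℝ] C₀(ℕ, ℝ),
        (∀ (x : C₀(ℕ, ℝ)) (n : ℕ), (T x) n = w (n + 1) * x (n + 1)) ∧
        FrequentlyHypercyclic T ∧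
        ∃ U V : Set (C₀(ℕ, ℝ)), IsOpen U ∧ U.Nonempty ∧ IsOpen V ∧ V.Nonempty ∧
          upperDensity {n : ℕ | ∃ x ∈ U, (T ^ n) x ∈ V} < 1 := by
  obtain ⟨y, r, g, hy0, hyb, hrg, hdense⟩ := dense_data
  set h := hgt (G1 ∪ G2 g) with hh
  have hsucc : ∀ n, h (n + 1) ≤ h n + 1 := hgt_succ_le _
  have h00 : h 0 = 0 := by rw [hh, hgt]
  have hle : ∀ k, h k ≤ k := by
    intro k
    induction k with
    | zero => omega
    | succ k ih => have := hsucc k; omega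
  have hpos : ∀ n, (0 : ℝ) < 2 ^ h n := fun n => by positivity
  set w : ℕ → ℝ := fun n => 2 ^ h n / 2 ^ h (n - 1) with hwdef
  have hw0 : ∀ n, 0 < w n := fun n => div_pos (hpos _) (hpos _)
  have hw2 : ∀ n, w n ≤ 2 := by
    intro n
    simp only [hwdef]
    rw [div_le_iff₀ (hpos _), ← pow_succ']
    apply pow_le_pow_right₀ (by norm_num)
    cases n with
    | zero => simp
    | succ n => exact hsucc n
  have hw : ∀ n, w (n + 1) * 2 ^ h n = 2 ^ h (n + 1) := by
    intro n
    simp only [hwdef, Nat.add_sub_cancel]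
    exact div_mul_cancel₀ _ (hpos _).ne'
  obtain ⟨T, hT⟩ := exists_shift w hw0 hw2
  have hTn := shift_pow h w hw T hT
  have hdist : ∀ (a b : C₀(ℕ, ℝ)) (i : ℕ), |a i - b i| ≤ dist a b := by
    intro a b i
    rw [← ZeroAtInftyContinuousMap.dist_toBCF_eq_dist, ← Real.dist_eq]
    exact BoundedContinuousFunction.dist_coe_le_dist (f := a.toBCF) (g := b.toBCF) i
  have hdist' : ∀ (a b : C₀(ℕ, ℝ)) (c : ℝ), 0 ≤ c → (∀ i, |a i - b i| ≤ c) → dist a b ≤ c := by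
    intro a b c hc H
    rw [← ZeroAtInftyContinuousMap.dist_toBCF_eq_dist, BoundedContinuousFunction.dist_le hc]
    intro i
    rw [Real.dist_eq]
    exact H i
  refine ⟨w, hw0, ⟨2, hw2⟩, T, hT, ?_, ?_⟩
  · -- frequent hypercyclicity
    have hz : ∀ l, ∃ v : ℝ, (∀ p n k, n ∈ EE g p → k ≤ g p → l = n + k → v = y p k * 2 ^ h k) ∧
        ((¬ ∃ p n k, n ∈ EE g p ∧ k ≤ g p ∧ l = n + k) → v = 0) := by
      intro l
      by_cases hl : ∃ p n k, n ∈ EE g p ∧ k ≤ g p ∧ l = n + k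
      · obtain ⟨p, n, k, h1, h2, h3⟩ := hl
        refine ⟨y p k * 2 ^ h k, ?_, fun h' => absurd ⟨p, n, k, h1, h2, h3⟩ h'⟩
        intro p' n' k' h1' h2' h3'
        obtain ⟨rfl, rfl⟩ := EE_disj g p p' n n' k k' h1 h1' h2 h2' (by omega)
        have : k = k' := by omega
        rw [this]
      · exact ⟨0, fun p n k h1 h2 h3 => absurd ⟨p, n, k, h1, h2, h3⟩ hl, fun _ => rfl⟩
    choose z hz1 hz2 using hz
    have hybd : ∀ p k, |y p k * 2 ^ h k| ≤ 2 ^ g p := by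
      intro p k
      rw [abs_mul, abs_of_pos (hpos k)]
      refine le_trans ?_ (hyb p k)
      gcongr
      · norm_num
      · exact hle k
    have hzb : ∀ l, |z l / 2 ^ h l| ≤ (1 / 2) ^ (l / 16) := by
      intro l
      by_cases hl : ∃ p n k, n ∈ EE g p ∧ k ≤ g p ∧ l = n + k
      · obtain ⟨p, n, k, h1, h2, h3⟩ := hl
        have hi := EE_inf g p n k h1 h2
        rw [← h3, ← hh] at hi
        rw [hz1 l p n k h1 h2 h3, abs_div, abs_of_pos (hpos l), div_le_iff₀ (hpos l)]
        refine (hybd p k).trans ?_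
        calc (2 : ℝ) ^ g p = (1 / 2) ^ (l / 16) * 2 ^ (g p + l / 16) := by
              rw [pow_add, one_div, inv_pow]; field_simp
          _ ≤ _ := by gcongr; norm_num
      · rw [hz2 l hl]; simp
    have hzt : Tendsto (fun l => z l / 2 ^ h l) (cocompact ℕ) (𝓝 0) := by
      rw [cocompact_eq_cofinite, Nat.cofinite_eq_atTop]
      refine squeeze_zero_norm (fun n => hzb n) ?_
      exact (tendsto_pow_atTop_nhds_zero_of_lt_one (by norm_num) (by norm_num)).comp
        (Nat.tendsto_div_const_atTop (by norm_num))
    let x : C₀(ℕ, ℝ) := ⟨⟨fun l => z l / 2 ^ h l, continuous_of_discreteTopology⟩, hzt⟩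
    have hx : ∀ l, 2 ^ h l * x l = z l := fun l => mul_div_cancel₀ _ (hpos l).ne'
    refine ⟨x, ?_⟩
    rintro V hV ⟨f, hf⟩
    obtain ⟨ε, hε, hball⟩ := Metric.isOpen_iff.1 hV f hf
    obtain ⟨q, hq1, hq2⟩ := hdense f (ε / 3) (by positivity)
    refine lt_of_lt_of_le (EE_density g q) (lowerDensity_mono ?_)
    intro m hm
    show (T ^ m) x ∈ V
    apply hball
    rw [Metric.mem_ball]
    refine lt_of_le_of_lt (hdist' _ _ (2 * (ε / 3)) (by positivity) ?_) (by linarith)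
    intro i
    have hv : ((T ^ m) x) i = z (i + m) / 2 ^ h i := by
      rw [eq_div_iff (hpos i).ne', hTn, hx]
    have key : |((T ^ m) x) i - y q i| ≤ (1 / 2) ^ r q := by
      rw [hv]
      by_cases hi : i ≤ g q
      · rw [hz1 (i + m) q m i hm hi (by omega), mul_div_cancel_right₀ _ (hpos i).ne']
        simp
      · rw [hy0 q i (by omega), sub_zero]
        by_cases hl : ∃ p n k, n ∈ EE g p ∧ k ≤ g p ∧ i + m = n + k
        · obtain ⟨p, n, k, h1, h2, h3⟩ := hl
          rcases lt_trichotomy n m with hlt | heq | hgt'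
          · have := EE_disj g p q n m (m - n) 0 h1 hm (by omega) (by omega) (by omega)
            omega
          · have := EE_disj g p q n m 0 0 h1 hm (by omega) (by omega) (by omega)
            obtain ⟨rfl, _⟩ := this
            omega
          · have hd := EE_diff g p q n m k h1 hm hgt' h2
            rw [← hh, show n + k - m = i by omega] at hd
            rw [hz1 _ p n k h1 h2 h3, abs_div, abs_of_pos (hpos i), div_le_iff₀ (hpos i)]
            refine (hybd p k).trans ?_
            have := hrg q
            calc (2 : ℝ) ^ g p = (1 / 2) ^ (r q) * 2 ^ (g p + r q) := by
                  rw [pow_add, one_div, inv_pow]; field_simp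
              _ ≤ _ := by
                gcongr
                · norm_num
                · omega
        · rw [hz2 _ hl]; simp
    calc |((T ^ m) x) i - f i| ≤ |((T ^ m) x) i - y q i| + |y q i - f i| := abs_sub_le _ _ _
      _ ≤ ε / 3 + ε / 3 := add_le_add (key.trans hq1.le) (hq2 i)
      _ = _ := by ring
  · -- not transitive
    let e0 : C₀(ℕ, ℝ) := ⟨⟨fun l => if l = 0 then 1 else 0, continuous_of_discreteTopology⟩, by
      rw [cocompact_eq_cofinite, Nat.cofinite_eq_atTop]
      apply tendsto_const_nhds.congr'
      filter_upwards [eventually_gt_atTop 0] with n hn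
      simp [hn.ne']⟩
    have he0 : e0 0 = 1 := by
      show (if (0 : ℕ) = 0 then (1 : ℝ) else 0) = 1
      simp
    refine ⟨Metric.ball 0 (1 / 2), Metric.ball e0 (1 / 2), Metric.isOpen_ball,
      ⟨0, Metric.mem_ball_self (by norm_num)⟩, Metric.isOpen_ball,
      ⟨e0, Metric.mem_ball_self (by norm_num)⟩, ?_⟩
    refine lt_of_le_of_lt (upperDensity_mono ?_) (G_density g)
    rintro n ⟨x, hxU, hxV⟩
    apply mem_of_hgt_ne
    rw [← hh]
    intro hn0
    have h1 := hTn n x 0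
    rw [zero_add, hn0, h00] at h1
    simp only [pow_zero, mul_one, one_mul] at h1
    have h2 := (hdist x 0 n).trans_lt (Metric.mem_ball.1 hxU)
    have h3 := (hdist ((T ^ n) x) e0 0).trans_lt (Metric.mem_ball.1 hxV)
    rw [h1, he0, abs_lt] at h3
    rw [ZeroAtInftyContinuousMap.zero_apply, sub_zero, abs_lt] at h2
    linarith [h2.2, h3.1]
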